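/- Let A be the n×n Jordan block with eigenvalue λ ∈ [0,1) and b ∈ R^n with last entry b_n. Then the volume of the infinite-horizon reachable zonotope R_∞ = {∑_{k≥0} A^k b u_k : |u_k| ≤ 1} equals 2^n · |b_n|^n / ((1-λ)^n · (1-λ^2)^{n(n-1)/2}). -/

import Mathlib

open MeasureTheory

def Zon {n : ℕ} (v : ℕ → Fin n → ℝ) : Set (Fin n → ℝ) :=
  {x | ∃ u : ℕ → ℝ, (∀ k, |u k| ≤ 1) ∧ HasSum (fun k => u k • v k) x}

lemma zon_norm_bound {n : ℕ} {v : ℕ → Fin n → ℝ} {u : ℕ → ℝ}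
    (hu : ∀ k, |u k| ≤ 1) (k : ℕ) : ‖u k • v k‖ ≤ ‖v k‖ := by
  rw [norm_smul, Real.norm_eq_abs]
  exact mul_le_of_le_one_left (norm_nonneg _) (hu k)

lemma zon_summable {n : ℕ} {v : ℕ → Fin n → ℝ} (hv : Summable v) {u : ℕ → ℝ}
    (hu : ∀ k, |u k| ≤ 1) : Summable (fun k => u k • v k) :=
  Summable.of_norm_bounded hv.norm (zon_norm_bound hu)

lemma zon_image {n m : ℕ} {v : ℕ → Fin n → ℝ} (hv : Summable v)
    (M : (Fin n → ℝ) →ₗ[ℝ] (Fin m → ℝ)) : M '' Zon v = Zon (fun k => M (v k)) := by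
  have key : ∀ u : ℕ → ℝ, ∀ x, HasSum (fun k => u k • v k) x →
      HasSum (fun k => u k • M (v k)) (M x) := by
    intro u x h
    have := h.mapL (LinearMap.toContinuousLinearMap M)
    simpa using this
  ext y
  constructor
  · rintro ⟨x, ⟨u, hu, h⟩, rfl⟩
    exact ⟨u, hu, key u x h⟩
  · rintro ⟨u, hu, h⟩
    refine ⟨_, ⟨u, hu, (zon_summable hv hu).hasSum⟩, ?_⟩
    exact (key u _ (zon_summable hv hu).hasSum).unique h

lemma zon_convex {n : ℕ} (v : ℕ → Fin n → ℝ) : Convex ℝ (Zon v) := by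
  rintro x ⟨u, hu, hx⟩ y ⟨w, hw, hy⟩ a b ha hb hab
  refine ⟨fun k => a * u k + b * w k, fun k => ?_, ?_⟩
  · have h1 := abs_le.1 (hu k)
    have h2 := abs_le.1 (hw k)
    rw [abs_le]
    constructor <;> nlinarith
  · convert (hx.const_smul a).add (hy.const_smul b) using 2 with k
    rw [add_smul, mul_smul, mul_smul]

lemma zon_compact {n : ℕ} {v : ℕ → Fin n → ℝ} (hv : Summable v) : IsCompact (Zon v) := by
  have hc : IsCompact (Set.pi Set.univ (fun _ : ℕ => Set.Icc (-1 : ℝ) 1)) :=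
    isCompact_univ_pi (fun _ => isCompact_Icc)
  have hcont : ContinuousOn (fun u : ℕ → ℝ => ∑' k, u k • v k)
      (Set.pi Set.univ (fun _ : ℕ => Set.Icc (-1 : ℝ) 1)) := by
    refine continuousOn_tsum (u := fun k => ‖v k‖) (fun k => ?_) hv.norm ?_
    · fun_prop
    · intro k u hu
      exact zon_norm_bound (fun k => abs_le.2 (hu k (Set.mem_univ _))) k
  convert hc.image_of_continuousOn hcont using 1
  ext x
  constructor
  · rintro ⟨u, hu, h⟩
    exact ⟨u, fun k _ => abs_le.1 (hu k), h.tsum_eq⟩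
  · rintro ⟨u, hu, rfl⟩
    have hu' : ∀ k, |u k| ≤ 1 := fun k => abs_le.2 (hu k (Set.mem_univ _))
    exact ⟨u, hu', (zon_summable hv hu').hasSum⟩

lemma zon_succ {n : ℕ} (v : ℕ → Fin n → ℝ) :
    Zon v = {x | ∃ a : ℝ, |a| ≤ 1 ∧ ∃ y ∈ Zon (fun k => v (k + 1)), x = a • v 0 + y} := by
  ext x
  constructor
  · rintro ⟨u, hu, h⟩
    refine ⟨u 0, hu 0, x - u 0 • v 0, ⟨fun k => u (k + 1), fun k => hu _, ?_⟩, by abel⟩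
    have := (hasSum_nat_add_iff' (f := fun k => u k • v k) 1).2 h
    simpa using this
  · rintro ⟨a, ha, y, ⟨u, hu, h⟩, rfl⟩
    refine ⟨fun k => Nat.casesOn k a u, fun k => ?_, ?_⟩
    · cases k <;> simp [ha, hu]
    · rw [← hasSum_nat_add_iff' 1]
      simpa using h

lemma zon_tail_tendsto {n : ℕ} {v : ℕ → Fin (n + 1) → ℝ} (hv : Summable v) :
    Filter.Tendsto (fun N => volume (Zon (fun k => v (k + N)))) Filter.atTop (nhds 0) := by
  have h1 := tendsto_sum_nat_add (fun k => ‖v k‖)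
  have h2 : Filter.Tendsto (fun N => ENNReal.ofReal ((2 * ∑' k, ‖v (k + N)‖) ^ (n + 1)))
      Filter.atTop (nhds 0) := by
    have := ((h1.const_mul 2).pow (n + 1))
    have := ENNReal.tendsto_ofReal this
    simpa using this
  refine tendsto_of_tendsto_of_tendsto_of_le_of_le tendsto_const_nhds h2 (fun _ => bot_le) ?_
  intro N
  have hs : Summable (fun k => ‖v (k + N)‖) := (summable_nat_add_iff N).2 hv.norm
  have hsub : Zon (fun k => v (k + N)) ⊆ Metric.closedBall 0 (∑' k, ‖v (k + N)‖) := by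
    rintro x ⟨u, hu, h⟩
    rw [mem_closedBall_zero_iff, ← h.tsum_eq]
    exact tsum_of_norm_bounded hs.hasSum (zon_norm_bound hu)
  refine (measure_mono hsub).trans ?_
  rw [Real.volume_pi_closedBall _ (tsum_nonneg (fun _ => norm_nonneg _))]
  simp

lemma volume_slice {n : ℕ} {S : Set (Fin (n + 1) → ℝ)} (hS : MeasurableSet S) :
    volume S = ∫⁻ y : Fin n → ℝ, volume {s : ℝ | (Fin.cons s y : Fin (n + 1) → ℝ) ∈ S} := by
  have hp := (volume_preserving_piFinSuccAbove (fun _ : Fin (n + 1) => ℝ) 0).symm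
  rw [← hp.measure_preimage hS.nullMeasurableSet]
  rw [Measure.volume_eq_prod, Measure.prod_apply_symm (hp.measurable hS)]
  refine lintegral_congr fun y => ?_
  congr 1
  ext s
  simp [MeasurableEquiv.piFinSuccAbove, Fin.insertNthEquiv]

lemma volume_thicken {n : ℕ} {K : Set (Fin (n + 1) → ℝ)} (hK : IsCompact K)
    (hC : Convex ℝ K) (c : ℝ) (hc : 0 ≤ c) (e : Fin (n + 1) → ℝ) (he : e = Fin.cons c 0) :
    volume {x | ∃ a : ℝ, |a| ≤ 1 ∧ ∃ y ∈ K, x = a • e + y} =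
      volume K + ENNReal.ofReal (2 * c) * volume ((LinearMap.funLeft ℝ ℝ Fin.succ) '' K) := by
  have hK' : IsCompact {x | ∃ a : ℝ, |a| ≤ 1 ∧ ∃ y ∈ K, x = a • e + y} := by
    have := ((isCompact_Icc (a := (-1 : ℝ)) (b := 1)).prod hK).image
      (f := fun p : ℝ × (Fin (n + 1) → ℝ) => p.1 • e + p.2) (by fun_prop)
    convert this using 1
    ext x
    constructor
    · rintro ⟨a, ha, y, hy, rfl⟩
      exact ⟨(a, y), ⟨abs_le.1 ha, hy⟩, rfl⟩
    · rintro ⟨⟨a, y⟩, ⟨ha, hy⟩, rfl⟩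
      exact ⟨a, abs_le.2 ha, y, hy, rfl⟩
  have hP : IsCompact ((LinearMap.funLeft ℝ ℝ Fin.succ : (Fin (n+1) → ℝ) →ₗ[ℝ] _) '' K) :=
    hK.image (LinearMap.continuous_of_finiteDimensional _)
  rw [volume_slice hK'.measurableSet, volume_slice hK.measurableSet,
    ← lintegral_indicator_const hP.measurableSet, ← lintegral_add_right _
      (measurable_const.indicator hP.measurableSet)]
  refine lintegral_congr fun y => ?_
  have hfib : {s : ℝ | (Fin.cons s y : Fin (n + 1) → ℝ) ∈
      {x | ∃ a : ℝ, |a| ≤ 1 ∧ ∃ y ∈ K, x = a • e + y}} =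
      {s : ℝ | ∃ a : ℝ, |a| ≤ 1 ∧ (Fin.cons (s - a * c) y : Fin (n + 1) → ℝ) ∈ K} := by
    ext s
    constructor
    · rintro ⟨a, ha, z, hz, h⟩
      refine ⟨a, ha, ?_⟩
      convert hz using 1
      have : z = (Fin.cons s y : Fin (n + 1) → ℝ) - a • e := by rw [h]; abel
      rw [this, he]
      ext i
      refine Fin.cases ?_ (fun i => ?_) i <;> simp
    · rintro ⟨a, ha, h⟩
      refine ⟨a, ha, _, h, ?_⟩
      rw [he]
      ext i
      refine Fin.cases ?_ (fun i => ?_) i <;> simp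
  rw [hfib]
  set F : Set ℝ := {s : ℝ | (Fin.cons s y : Fin (n + 1) → ℝ) ∈ K} with hF
  by_cases hy : y ∈ (LinearMap.funLeft ℝ ℝ Fin.succ : (Fin (n+1) → ℝ) →ₗ[ℝ] _) '' K
  · rw [Set.indicator_of_mem hy]
    have hne : F.Nonempty := by
      obtain ⟨z, hz, rfl⟩ := hy
      refine ⟨z 0, ?_⟩
      simp only [hF, Set.mem_ofPred_eq]
      convert hz using 1
      ext i
      refine Fin.cases ?_ (fun i => ?_) i <;> simp [LinearMap.funLeft_apply]
    have hcl : IsClosed F := by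
      refine hK.isClosed.preimage (f := fun s : ℝ => (Fin.cons s y : Fin (n + 1) → ℝ)) ?_
      refine continuous_pi fun i => ?_
      refine Fin.cases ?_ (fun i => ?_) i <;> simp <;> fun_prop
    have hcp : IsCompact F := by
      refine Metric.isCompact_of_isClosed_isBounded hcl ?_
      have := (hK.image (continuous_apply (0 : Fin (n + 1)))).isBounded
      refine this.subset ?_
      intro s hs
      exact ⟨_, hs, by simp⟩
    have hcv : Convex ℝ F := by
      intro s hs t ht a b ha hb hab
      have := hC hs ht ha hb hab
      simp only [hF, Set.mem_ofPred_eq]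
      convert this using 1
      ext i
      refine Fin.cases ?_ (fun i => ?_) i <;> simp
      rw [← add_mul, hab, one_mul]
    have hicc := eq_Icc_of_connected_compact ⟨hne, hcv.isPreconnected⟩ hcp
    have hle : sInf F ≤ sSup F := Set.nonempty_Icc.1 (hicc ▸ hne)
    set l := sInf F
    set r := sSup F
    have hthick : {s : ℝ | ∃ a : ℝ, |a| ≤ 1 ∧ (Fin.cons (s - a * c) y : Fin (n + 1) → ℝ) ∈ K}
        = Set.Icc (l - c) (r + c) := by
      have : {s : ℝ | ∃ a : ℝ, |a| ≤ 1 ∧ (Fin.cons (s - a * c) y : Fin (n + 1) → ℝ) ∈ K}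
        = {s : ℝ | ∃ a : ℝ, |a| ≤ 1 ∧ s - a * c ∈ F} := rfl
      rw [this, hicc]
      ext s
      simp only [Set.mem_ofPred_eq, Set.mem_Icc]
      constructor
      · rintro ⟨a, ha, h1, h2⟩
        have := abs_le.1 ha
        constructor <;> nlinarith
      · rintro ⟨h1, h2⟩
        rcases hc.eq_or_lt with h0 | h0
        · refine ⟨0, by simp, ?_⟩
          constructor <;> linarith
        · by_cases h3 : s < l
          · have hd : (s - l) / c * c = s - l := div_mul_cancel₀ _ h0.ne'
            refine ⟨(s - l) / c, ?_, by linarith, by linarith⟩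
            rw [abs_le, le_div_iff₀ h0, div_le_iff₀ h0]
            constructor <;> linarith
          · by_cases h4 : r < s
            · have hd : (s - r) / c * c = s - r := div_mul_cancel₀ _ h0.ne'
              refine ⟨(s - r) / c, ?_, by linarith, by linarith⟩
              rw [abs_le, le_div_iff₀ h0, div_le_iff₀ h0]
              constructor <;> linarith
            · exact ⟨0, by simp, by linarith, by linarith⟩
    rw [hthick, hicc, Real.volume_Icc, Real.volume_Icc, ← ENNReal.ofReal_add (by linarith)
      (by linarith)]
    congr 1
    ring
  · rw [Set.indicator_of_notMem hy, add_zero]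
    have hz : ∀ s : ℝ, (Fin.cons s y : Fin (n + 1) → ℝ) ∉ K := by
      intro s hs
      refine hy ⟨_, hs, ?_⟩
      ext i
      simp [LinearMap.funLeft_apply]
    have : F = ∅ := Set.eq_empty_of_forall_notMem hz
    rw [this]
    simp [hz]

def kk : (n : ℕ) → (Fin n → ℕ) → Fin n → ℕ
  | 0, _ => Fin.elim0
  | n + 1, g => Fin.cons (g 0) (fun i => g 0 + 1 + kk n (Fin.tail g) i)

lemma kk_cons {n : ℕ} (a : ℕ) (g : Fin n → ℕ) :
    kk (n + 1) (Fin.cons a g : Fin (n + 1) → ℕ) = Fin.cons a (fun i => a + 1 + kk n g i) := by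
  simp [kk]

lemma kk_strictMono (n : ℕ) (g : Fin n → ℕ) : StrictMono (kk n g) := by
  induction n with
  | zero => intro i; exact i.elim0
  | succ n ih =>
    intro i j
    refine Fin.cases ?_ (fun i => ?_) i <;> refine Fin.cases ?_ (fun j => ?_) j
    · simp
    · intro _
      simp [kk]
      omega
    · simp
    · intro h
      have := ih (Fin.tail g) (Fin.succ_lt_succ_iff.1 h)
      simpa [kk] using this

noncomputable def TT (n : ℕ) (w t : ℕ → ℝ) (g : Fin n → ℕ) : ℝ :=
  (∏ i, w (kk n g i)) * ∏ i, ∏ j ∈ Finset.Ioi i, (t (kk n g j) - t (kk n g i))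

lemma TT_cons {n : ℕ} (w t : ℕ → ℝ) (a : ℕ) (g : Fin n → ℕ) :
    TT (n + 1) w t (Fin.cons a g : Fin (n + 1) → ℕ) =
      w a * TT n (fun j => w (a + 1 + j) * (t (a + 1 + j) - t a)) (fun j => t (a + 1 + j)) g := by
  unfold TT
  rw [kk_cons, Fin.prod_univ_succ, Fin.prod_univ_succ]
  simp only [Fin.prod_Ioi_zero, Fin.prod_Ioi_succ, Fin.cons_zero, Fin.cons_succ,
    Finset.prod_mul_distrib]
  ring

lemma TT_nonneg {n : ℕ} {w t : ℕ → ℝ} (hw : ∀ k, 0 ≤ w k) (ht : Monotone t) (g : Fin n → ℕ) :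
    0 ≤ TT n w t g := by
  refine mul_nonneg (Finset.prod_nonneg fun i _ => hw _)
    (Finset.prod_nonneg fun i _ => Finset.prod_nonneg fun j hj => ?_)
  have := ht ((kk_strictMono n g).monotone (Finset.mem_Ioi.1 hj).le)
  linarith

def mv (n : ℕ) (w t : ℕ → ℝ) (k : ℕ) : Fin n → ℝ := fun i => w k * t k ^ (i : ℕ)

def shearM (n : ℕ) (c : ℝ) : Matrix (Fin (n + 1)) (Fin (n + 1)) ℝ :=
  Matrix.of (Fin.cons (Pi.single 0 1) (fun i : Fin n =>
    (Pi.single i.succ 1 - c • Pi.single i.castSucc 1 : Fin (n + 1) → ℝ)))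

lemma shearM_det (n : ℕ) (c : ℝ) : (shearM n c).det = 1 := by
  rw [Matrix.det_of_isLowerTriangular]
  · refine Finset.prod_eq_one fun i _ => ?_
    refine Fin.cases ?_ (fun i => ?_) i
    · simp [shearM]
    · simp [shearM, (Fin.castSucc_lt_succ (i := i)).ne']
  · intro i j
    refine Fin.cases ?_ (fun i => ?_) i
    · intro h
      have h : j ≠ 0 := by
        rintro rfl
        simp at h
      simp [shearM, h]
    · intro h
      have h : i.succ < j := h
      have h2 : i.castSucc < j := lt_trans Fin.castSucc_lt_succ h
      simp [shearM, h.ne', h2.ne']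

lemma shearM_mv (n : ℕ) (c : ℝ) (w t : ℕ → ℝ) (k : ℕ) :
    Matrix.toLin' (shearM n c) (mv (n + 1) w t k) =
      Fin.cons (w k) (mv n (fun k => w k * (t k - c)) t k) := by
  ext i
  refine Fin.cases ?_ (fun i => ?_) i
  · simp [shearM, Matrix.mulVec, mv]
  · have : Matrix.toLin' (shearM n c) (mv (n + 1) w t k) i.succ =
        (Pi.single i.succ 1 - c • Pi.single i.castSucc 1 : Fin (n + 1) → ℝ) ⬝ᵥ
          mv (n + 1) w t k := by
      rfl
    rw [this, sub_dotProduct, smul_dotProduct]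
    simp [mv]
    ring

lemma vol_zon_matrix {n : ℕ} {v : ℕ → Fin n → ℝ} (hv : Summable v) (M : Matrix (Fin n) (Fin n) ℝ) :
    volume (Zon (fun k => Matrix.toLin' M (v k))) = ENNReal.ofReal |M.det| * volume (Zon v) := by
  rw [← zon_image hv, Measure.addHaar_image_linearMap, LinearMap.det_toLin']

lemma summable_mv_sub {n : ℕ} {w t : ℕ → ℝ} (h : Summable (mv (n + 1) w t)) (c : ℝ) :
    Summable (mv n (fun k => w k * (t k - c)) t) := by
  rw [Pi.summable] at h ⊢
  intro i
  have h1 := h i.succ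
  have h2 := (h i.castSucc).mul_left c
  refine (h1.sub h2).congr fun k => ?_
  simp [mv]
  ring

lemma vol_step {n : ℕ} {w t : ℕ → ℝ} (h : Summable (mv (n + 1) w t)) (hw : 0 ≤ w 0) :
    volume (Zon (mv (n + 1) w t)) =
      volume (Zon (mv (n + 1) (fun k => w (k + 1)) (fun k => t (k + 1)))) +
      ENNReal.ofReal (2 * w 0) *
        volume (Zon (mv n (fun k => w (k + 1) * (t (k + 1) - t 0)) (fun k => t (k + 1)))) := by
  have h' : Summable (mv (n + 1) (fun k => w (k + 1)) (fun k => t (k + 1))) :=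
    (summable_nat_add_iff 1).2 h
  have e1 := vol_zon_matrix h (shearM n (t 0))
  have e2 := vol_zon_matrix h' (shearM n (t 0))
  rw [shearM_det, abs_one, ENNReal.ofReal_one, one_mul] at e1 e2
  have hs : Summable (fun k => Matrix.toLin' (shearM n (t 0))
      (mv (n + 1) (fun k => w (k + 1)) (fun k => t (k + 1)) k)) :=
    h'.map (Matrix.toLin' (shearM n (t 0))) (LinearMap.continuous_of_finiteDimensional _)
  rw [← e1, ← e2, zon_succ]
  have := volume_thicken (zon_compact hs) (zon_convex _) (w 0) hw
    (Matrix.toLin' (shearM n (t 0)) (mv (n + 1) w t 0)) (by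
      rw [shearM_mv]
      congr 1
      ext i
      simp [mv])
  rw [zon_image hs] at this
  refine this.trans ?_
  congr 4
  ext k i
  rw [shearM_mv]
  simp [LinearMap.funLeft_apply]

lemma summable_mv_shift {n : ℕ} {w t : ℕ → ℝ} (h : Summable (mv n w t)) (N : ℕ) :
    Summable (mv n (fun k => w (N + k)) (fun k => t (N + k))) := by
  have := (summable_nat_add_iff N).2 h
  refine this.congr fun k => ?_
  rw [add_comm]
  rfl

lemma vol_iter {n : ℕ} {w t : ℕ → ℝ} (h : Summable (mv (n + 1) w t)) (hw : ∀ k, 0 ≤ w k) (N : ℕ) :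
    volume (Zon (mv (n + 1) w t)) =
      ∑ a ∈ Finset.range N, ENNReal.ofReal (2 * w a) *
        volume (Zon (mv n (fun k => w (a + 1 + k) * (t (a + 1 + k) - t a))
          (fun k => t (a + 1 + k)))) +
      volume (Zon (mv (n + 1) (fun k => w (N + k)) (fun k => t (N + k)))) := by
  induction N with
  | zero => simp
  | succ N ih =>
    rw [ih, Finset.sum_range_succ, vol_step (summable_mv_shift h N) (hw _)]
    simp only [add_zero, ← add_assoc, add_right_comm]

theorem vol_zon_mv (n : ℕ) : ∀ (w t : ℕ → ℝ), (∀ k, 0 ≤ w k) → StrictMono t →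
    Summable (mv n w t) →
    volume (Zon (mv n w t)) = 2 ^ n * ∑' g : Fin n → ℕ, ENNReal.ofReal (TT n w t g) := by
  induction n with
  | zero =>
    intro w t hw ht h
    have : Zon (mv 0 w t) = Set.univ := by
      ext x
      simp only [Set.mem_univ, iff_true]
      refine ⟨0, by simp, ?_⟩
      convert hasSum_zero using 1
    rw [this, tsum_fintype]
    simp [TT, volume_pi]
  | succ n ih =>
    intro w t hw ht h
    have hlim : Filter.Tendsto (fun N => ∑ a ∈ Finset.range N, ENNReal.ofReal (2 * w a) *
        volume (Zon (mv n (fun k => w (a + 1 + k) * (t (a + 1 + k) - t a))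
          (fun k => t (a + 1 + k)))) +
      volume (Zon (mv (n + 1) (fun k => w (N + k)) (fun k => t (N + k))))) Filter.atTop
      (nhds (∑' a, ENNReal.ofReal (2 * w a) *
        volume (Zon (mv n (fun k => w (a + 1 + k) * (t (a + 1 + k) - t a))
          (fun k => t (a + 1 + k)))) + 0)) := by
      refine (ENNReal.tendsto_nat_tsum _).add ?_
      have := zon_tail_tendsto h
      refine this.congr fun N => ?_
      congr 2
      ext k i
      simp [mv, add_comm]
    have heq := tendsto_nhds_unique (tendsto_const_nhds.congr fun N => vol_iter h hw N) hlim
    rw [heq, add_zero, ← (Fin.consEquiv (fun _ : Fin (n + 1) => ℕ)).tsum_eq]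
    rw [ENNReal.tsum_prod', ← ENNReal.tsum_mul_left]
    refine tsum_congr fun a => ?_
    have hpos : ∀ k, 0 ≤ t (a + 1 + k) - t a := fun k =>
      sub_nonneg.2 (ht.monotone (by omega))
    rw [ih _ _ (fun k => mul_nonneg (hw _) (hpos k)) (fun i j hij => ht (by omega))]
    · rw [ENNReal.ofReal_mul (by norm_num), ← ENNReal.tsum_mul_left, ← ENNReal.tsum_mul_left,
        ← ENNReal.tsum_mul_left]
      refine tsum_congr fun g => ?_
      change _ = 2 ^ (n + 1) * ENNReal.ofReal (TT (n + 1) w t (Fin.cons a g))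
      rw [TT_cons, ENNReal.ofReal_mul (hw a)]
      simp only [ENNReal.ofReal_ofNat]
      ring
    · exact summable_mv_sub (summable_mv_shift h (a + 1)) (t a)

lemma lagrange_id {n : ℕ} (x : Fin (n + 1) → ℝ) (h0 : ∀ i, 0 ≤ x i)
    (hinj : Function.Injective x) :
    1 - ∏ i, x i = ∑ j : Fin (n + 1), (∏ l, x (j.succAbove l)) * ((1 - x j) *
      ∏ l, ((1 - x j * x (j.succAbove l)) / (x (j.succAbove l) - x j))) := by
  classical
  let Q : Polynomial ℝ := ∏ j, (1 - Polynomial.C (x j) * Polynomial.X)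
  let M : Polynomial ℝ := ∏ j, (Polynomial.X - Polynomial.C (x j))
  let D : Polynomial ℝ := Q - Polynomial.C ((-1) ^ (n + 1)) * M
  have hQ : ∀ z, Q.eval z = ∏ j, (1 - x j * z) := by
    intro z; simp [Q, Polynomial.eval_prod]
  have hM : ∀ z, M.eval z = ∏ j, (z - x j) := by
    intro z; simp [M, Polynomial.eval_prod]
  have hD : ∀ z, D.eval z = ∏ j, (1 - x j * z) - (-1) ^ (n + 1) * ∏ j, (z - x j) := by
    intro z; simp [D, hQ, hM]
  have hneg : ∀ f : Fin (n + 1) → ℝ, ∏ j, (- f j) = (-1) ^ (n + 1) * ∏ j, f j := by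
    intro f
    rw [Finset.prod_neg]
    simp
  have hsq : ((-1 : ℝ) ^ (n + 1)) * (-1) ^ (n + 1) = 1 := by
    rw [← mul_pow]; simp
  have hroot : D.IsRoot (-1) := by
    rw [Polynomial.IsRoot, hD]
    have : ∏ j, (-1 - x j) = (-1) ^ (n + 1) * ∏ j, (1 - x j * (-1)) := by
      rw [← hneg]
      refine Finset.prod_congr rfl fun j _ => ?_
      ring
    rw [this, ← mul_assoc, hsq]
    ring
  obtain ⟨P, hP⟩ := Polynomial.dvd_iff_isRoot.2 hroot
  have hDdeg : D.natDegree ≤ n + 1 := by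
    refine (Polynomial.natDegree_sub_le _ _).trans (max_le ?_ ?_)
    · refine (Polynomial.natDegree_prod_le _ _).trans ?_
      refine (Finset.sum_le_sum (g := fun _ => 1) fun j _ => ?_).trans (by simp)
      compute_degree
    · refine (Polynomial.natDegree_C_mul_le _ _).trans ?_
      refine (Polynomial.natDegree_prod_le _ _).trans ?_
      refine (Finset.sum_le_sum (g := fun _ => 1) fun j _ => ?_).trans (by simp)
      compute_degree
  have hPdeg : P.degree < (Finset.univ : Finset (Fin (n + 1))).card := by
    by_cases hP0 : P = 0
    · rw [hP0, Polynomial.degree_zero]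
      exact WithBot.bot_lt_coe _
    · rw [hP, Polynomial.natDegree_mul (Polynomial.X_sub_C_ne_zero _) hP0,
        Polynomial.natDegree_X_sub_C] at hDdeg
      rw [Polynomial.degree_eq_natDegree hP0, Finset.card_univ, Fintype.card_fin]
      exact_mod_cast (by omega : P.natDegree < n + 1)
  have hPz : ∀ z, D.eval z = (z + 1) * P.eval z := by
    intro z
    rw [hP]
    simp
  have hP0 : P.eval 0 = 1 - ∏ i, x i := by
    have := hPz 0
    rw [hD] at this
    simp only [mul_zero, sub_zero, Finset.prod_const_one, zero_sub, hneg, zero_add,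
      one_mul] at this
    rw [← this, ← mul_assoc, hsq, one_mul]
  have hPx : ∀ j, P.eval (x j) = (1 - x j) * ∏ l, (1 - x j * x (j.succAbove l)) := by
    intro j
    have := hPz (x j)
    have hz : ∏ i, (x j - x i) = 0 := Finset.prod_eq_zero (Finset.mem_univ j) (sub_self _)
    rw [hD, hz, Fin.prod_univ_succAbove _ j] at this
    have hne : x j + 1 ≠ 0 := by have := h0 j; positivity
    apply mul_left_cancel₀ hne
    rw [← this]
    have : ∀ l, 1 - x j * x (j.succAbove l) = 1 - x (j.succAbove l) * x j := fun l => by ring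
    simp only [this]
    ring
  have hint := Lagrange.eq_interpolate (s := Finset.univ) (v := x) hinj.injOn hPdeg
  have he := congrArg (Polynomial.eval 0) hint
  rw [hP0, Lagrange.interpolate_apply, Polynomial.eval_finsetSum] at he
  rw [he]
  refine Finset.sum_congr rfl fun j _ => ?_
  rw [Polynomial.eval_mul, Polynomial.eval_C, hPx, Lagrange.basis, Polynomial.eval_prod]
  have hb : ∏ i ∈ Finset.univ.erase j, (Lagrange.basisDivisor (x j) (x i)).eval 0 =
      ∏ l, (x (j.succAbove l) / (x (j.succAbove l) - x j)) := by
    have : Finset.univ.erase j = Finset.univ.image j.succAbove := by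
      rw [Fin.image_succAbove_univ]
      ext i; simp
    rw [this, Finset.prod_image (fun a _ b _ h => Fin.succAbove_right_injective h)]
    refine Finset.prod_congr rfl fun l _ => ?_
    simp only [Lagrange.basisDivisor, Polynomial.eval_mul, Polynomial.eval_C,
      Polynomial.eval_sub, Polynomial.eval_X]
    rw [← neg_sub (x (j.succAbove l)) (x j), inv_neg, div_eq_mul_inv]
    ring
  rw [hb, Finset.prod_div_distrib, Finset.prod_div_distrib]
  ring

lemma pair_prod_succAbove {n : ℕ} (F : Fin (n + 1) → Fin (n + 1) → ℝ)
    (hF : ∀ i j, F i j = - F j i) (j : Fin (n + 1)) :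
    ∏ i, ∏ k ∈ Finset.Ioi i, F i k = (-1) ^ (j : ℕ) * (∏ l, F j (j.succAbove l)) *
      ∏ i, ∏ k ∈ Finset.Ioi i, F (j.succAbove i) (j.succAbove k) := by
  have conv1 : ∀ (m : ℕ) (G : Fin m → Fin m → ℝ), ∏ i, ∏ k ∈ Finset.Ioi i, G i k =
      ∏ i, ∏ k, if i < k then G i k else 1 := by
    intro m G
    refine Finset.prod_congr rfl fun i _ => ?_
    rw [← Finset.prod_filter]
    congr 1
    ext k; simp
  rw [conv1, conv1, Fin.prod_univ_succAbove _ j]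
  simp only [Fin.prod_univ_succAbove _ j, lt_irrefl, if_false, one_mul,
    Finset.prod_mul_distrib, Fin.succAbove_lt_succAbove_iff]
  rw [← mul_assoc, ← Finset.prod_mul_distrib]
  congr 1
  have hs : ∏ l : Fin n, (if (l : ℕ) < j then (-1 : ℝ) else 1) = (-1) ^ (j : ℕ) := by
    rw [Finset.prod_ite]
    simp only [Finset.prod_const, one_pow, mul_one]
    congr 1
    rw [Fin.card_filter_val_lt]
    omega
  rw [← hs, ← Finset.prod_mul_distrib]
  refine Finset.prod_congr rfl fun l _ => ?_
  by_cases h : (l : ℕ) < j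
  · have h1 : j.succAbove l < j := by
      rw [Fin.succAbove_lt_iff_castSucc_lt]
      exact h
    simp only [h1, h, if_true, h1.not_gt, if_false, one_mul, hF (j.succAbove l) j]
    ring
  · have h1 : j < j.succAbove l := by
      rw [Fin.lt_succAbove_iff_le_castSucc]
      exact not_lt.1 h
    simp only [h1, h, if_true, h1.not_gt, if_false, mul_one, one_mul]

noncomputable def CF (n : ℕ) (x : Fin n → ℝ) : ℝ :=
  (∏ i, ∏ j ∈ Finset.Ioi i, ((x j - x i) / (1 - x i * x j))) / ∏ i, (1 - x i)

lemma CF_rec {n : ℕ} (x : Fin (n + 1) → ℝ) (h0 : ∀ i, 0 ≤ x i) (h1 : ∀ i, x i < 1)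
    (hinj : Function.Injective x) :
    (1 - ∏ i, x i) * CF (n + 1) x = ∑ j : Fin (n + 1), (-1) ^ (j : ℕ) *
      ((∏ l, x (j.succAbove l)) * CF n (fun l => x (j.succAbove l))) := by
  rw [lagrange_id x h0 hinj, Finset.sum_mul]
  refine Finset.sum_congr rfl fun j _ => ?_
  have hp := pair_prod_succAbove (fun i k => (x k - x i) / (1 - x i * x k)) (by
    intro i k
    rw [← neg_div, mul_comm (x i)]
    congr 1
    ring) j
  unfold CF
  rw [hp, Fin.prod_univ_succAbove (fun i => 1 - x i) j, Finset.prod_div_distrib,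
    Finset.prod_div_distrib]
  have n1 : 1 - x j ≠ 0 := by have := h1 j; linarith
  have n2 : ∏ l, (1 - x j * x (j.succAbove l)) ≠ 0 := by
    refine Finset.prod_ne_zero_iff.2 fun l _ => ?_
    have := h1 j; have := h1 (j.succAbove l); have := h0 j; have := h0 (j.succAbove l)
    nlinarith
  have n3 : ∏ l, (x (j.succAbove l) - x j) ≠ 0 := by
    refine Finset.prod_ne_zero_iff.2 fun l _ => ?_
    exact sub_ne_zero.2 fun h => Fin.succAbove_ne j l (hinj h)
  have n4 : ∏ l, (1 - x (j.succAbove l)) ≠ 0 := by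
    refine Finset.prod_ne_zero_iff.2 fun l _ => ?_
    have := h1 (j.succAbove l); linarith
  field_simp

lemma det_cons {n : ℕ} (x : Fin (n + 1) → ℝ) (a : ℕ) (g : Fin n → ℕ) :
    (Matrix.of fun i j => x j ^ kk (n + 1) (Fin.cons a g : Fin (n + 1) → ℕ) i).det =
      (∏ i, x i) ^ a * ∑ j : Fin (n + 1), (-1) ^ (j : ℕ) *
        ((∏ l, x (j.succAbove l)) *
          (Matrix.of fun i l => x (j.succAbove l) ^ kk n g i).det) := by
  rw [kk_cons]
  have e1 : (Matrix.of fun i j => x j ^ (Fin.cons a (fun i => a + 1 + kk n g i) :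
      Fin (n + 1) → ℕ) i) = Matrix.of fun i j => (x j ^ a) *
      (Matrix.of fun i j => x j ^ (Fin.cons 0 (fun i => 1 + kk n g i) : Fin (n + 1) → ℕ) i) i j
      := by
    ext i j
    refine Fin.cases ?_ (fun i => ?_) i
    · simp
    · simp only [Matrix.of_apply, Fin.cons_succ]
      rw [← pow_add, add_assoc]
  rw [e1, Matrix.det_mul_row, Finset.prod_pow]
  congr 1
  rw [Matrix.det_succ_row_zero]
  refine Finset.sum_congr rfl fun j _ => ?_
  simp only [Matrix.of_apply, Fin.cons_zero, pow_zero, mul_one]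
  congr 1
  rw [← Matrix.det_mul_row]
  congr 1
  ext i l
  simp [pow_add]

lemma hasSum_mul_aux {α β : Type*} {f : α → ℝ} {g : β → ℝ} {s t : ℝ} (hf : HasSum f s)
    (hg : HasSum g t) : HasSum (fun p : α × β => f p.1 * g p.2) (s * t) :=
  HasSum.mul hf hg (summable_mul_of_summable_norm (f := f) (g := g)
    (Summable.norm hf.summable) (Summable.norm hg.summable))

theorem hasSum_det (n : ℕ) : ∀ x : Fin n → ℝ, (∀ i, 0 ≤ x i) → (∀ i, x i < 1) →
    Function.Injective x →
    HasSum (fun g : Fin n → ℕ => (Matrix.of fun i j => x j ^ kk n g i).det) (CF n x) := by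
  induction n with
  | zero =>
    intro x _ _ _
    simp [CF]
  | succ n ih =>
    intro x h0 h1 hinj
    have hp0 : 0 ≤ ∏ i, x i := Finset.prod_nonneg fun i _ => h0 i
    have hp1 : ∏ i, x i < 1 := by
      rw [Fin.prod_univ_succ]
      have : ∏ i : Fin n, x i.succ ≤ 1 :=
        Finset.prod_le_one (fun i _ => h0 _) (fun i _ => (h1 _).le)
      have h2 := h1 0
      have h3 := h0 0
      nlinarith
    have hA := hasSum_geometric_of_lt_one hp0 hp1
    have hB : HasSum (fun g : Fin n → ℕ => ∑ j : Fin (n + 1), (-1) ^ (j : ℕ) *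
        ((∏ l, x (j.succAbove l)) *
          (Matrix.of fun i l => x (j.succAbove l) ^ kk n g i).det))
        (∑ j : Fin (n + 1), (-1) ^ (j : ℕ) *
      ((∏ l, x (j.succAbove l)) * CF n (fun l => x (j.succAbove l)))) := by
      refine hasSum_sum fun j _ => ?_
      refine ((ih _ (fun i => h0 _) (fun i => h1 _) ?_).mul_left _).mul_left _
      exact hinj.comp Fin.succAbove_right_injective
    have hAB := hasSum_mul_aux hA hB
    rw [← CF_rec x h0 h1 hinj, ← mul_assoc, inv_mul_cancel₀ (by linarith), one_mul] at hAB
    rw [← (Fin.consEquiv (fun _ : Fin (n + 1) => ℕ)).hasSum_iff]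
    have hfun : (fun g : Fin (n + 1) → ℕ => (Matrix.of fun i j => x j ^ kk (n + 1) g i).det) ∘
        (Fin.consEquiv (fun _ : Fin (n + 1) => ℕ)) = _ := funext fun p => det_cons x p.1 p.2
    rw [hfun]
    exact hAB

noncomputable def tq (q : ℝ) (k : ℕ) : ℝ := ∑ i ∈ Finset.range k, q ^ i

noncomputable def VAL (n : ℕ) (r q : ℝ) : ℝ :=
  (∏ i : Fin n, ∏ j ∈ Finset.Ioi i,
    (r * (tq q j - tq q i) / (1 - r * q ^ (i : ℕ) * (r * q ^ (j : ℕ))))) /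
    ∏ i : Fin n, (1 - r * q ^ (i : ℕ))

lemma tq_sub (q : ℝ) (a b : ℕ) : q ^ b - q ^ a = (q - 1) * (tq q b - tq q a) := by
  have h1 := mul_geom_sum q a
  have h2 := mul_geom_sum q b
  unfold tq
  linear_combination h1 - h2

lemma hasSum_TT (n : ℕ) (r q : ℝ) (hr0 : 0 < r) (hr1 : r < 1) (hq0 : 0 < q) (hq1 : q < 1) :
    HasSum (TT n (fun k => r ^ k) (tq q)) (VAL n r q) := by
  have hx1 : ∀ i : Fin n, r * q ^ (i : ℕ) < 1 := fun i => by
    have := pow_le_one₀ (n := (i : ℕ)) hq0.le hq1.le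
    have : 0 < q ^ (i : ℕ) := by positivity
    nlinarith
  have h := hasSum_det n (fun i => r * q ^ (i : ℕ)) (fun i => by positivity) hx1 (by
    intro i j hij
    have := mul_left_cancel₀ hr0.ne' hij
    exact Fin.ext (pow_right_injective₀ hq0 hq1.ne this))
  set E : ℝ := ∏ i : Fin n, ∏ j ∈ Finset.Ioi i, (q - 1) with hE
  have hE0 : E ≠ 0 := Finset.prod_ne_zero_iff.2 fun i _ => Finset.prod_ne_zero_iff.2 fun j _ =>
    sub_ne_zero.2 hq1.ne
  have hfun : (fun g => (Matrix.of fun i j : Fin n => (r * q ^ (j : ℕ)) ^ kk n g i).det) =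
      fun g => E * TT n (fun k => r ^ k) (tq q) g := by
    funext g
    have : (Matrix.of fun i j : Fin n => (r * q ^ (j : ℕ)) ^ kk n g i) =
        Matrix.of fun i j => (r ^ kk n g i) * (Matrix.vandermonde fun i => q ^ kk n g i) i j := by
      ext i j
      simp only [Matrix.of_apply, Matrix.vandermonde_apply]
      rw [mul_pow, ← pow_mul, ← pow_mul, mul_comm (j : ℕ)]
    rw [this, Matrix.det_mul_column, Matrix.det_vandermonde]
    simp only [tq_sub, Finset.prod_mul_distrib]
    rw [TT]
    ring
  have hval : CF n (fun i => r * q ^ (i : ℕ)) = E * VAL n r q := by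
    symm
    unfold VAL CF
    rw [← mul_div_assoc, hE, ← Finset.prod_mul_distrib]
    congr 1
    refine Finset.prod_congr rfl fun i _ => ?_
    rw [← Finset.prod_mul_distrib]
    refine Finset.prod_congr rfl fun j _ => ?_
    rw [← mul_sub, tq_sub]
    ring
  rw [hfun, hval] at h
  exact (hasSum_mul_left_iff hE0).1 h

lemma TT_mono (n : ℕ) (r q q' : ℝ) (hr0 : 0 < r) (hq0 : 0 ≤ q) (h : q ≤ q') (g : Fin n → ℕ) :
    TT n (fun k => r ^ k) (tq q) g ≤ TT n (fun k => r ^ k) (tq q') g := by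
  unfold TT
  have key : ∀ (p : ℝ) (i j : Fin n), i < j → tq p (kk n g j) - tq p (kk n g i) =
      ∑ k ∈ Finset.Ico (kk n g i) (kk n g j), p ^ k := by
    intro p i j hij
    rw [Finset.sum_Ico_eq_sub _ ((kk_strictMono n g).monotone hij.le)]
    rfl
  have nn : ∀ (p : ℝ) (i j : Fin n), 0 ≤ p → i < j → 0 ≤ tq p (kk n g j) - tq p (kk n g i) := by
    intro p i j hp hij
    rw [key p i j hij]
    positivity
  refine mul_le_mul_of_nonneg_left ?_ (Finset.prod_nonneg fun i _ => by positivity)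
  refine Finset.prod_le_prod (fun i _ => Finset.prod_nonneg fun j hj =>
    nn q i j hq0 (Finset.mem_Ioi.1 hj)) fun i _ => ?_
  refine Finset.prod_le_prod (fun j hj => nn q i j hq0 (Finset.mem_Ioi.1 hj)) fun j hj => ?_
  rw [key q i j (Finset.mem_Ioi.1 hj), key q' i j (Finset.mem_Ioi.1 hj)]
  exact Finset.sum_le_sum fun k _ => pow_le_pow_left₀ hq0 h k

lemma TT_cont (n : ℕ) (r : ℝ) (g : Fin n → ℕ) :
    Continuous (fun q => TT n (fun k => r ^ k) (tq q) g) := by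
  unfold TT tq
  fun_prop

lemma VAL_cont (n : ℕ) (r : ℝ) (hr0 : 0 < r) (hr1 : r < 1) :
    ContinuousAt (fun q => VAL n r q) 1 := by
  unfold VAL tq
  refine ContinuousAt.div ?_ (by fun_prop) ?_
  · refine tendsto_finsetProd _ fun i _ => tendsto_finsetProd _ fun j _ => ?_
    refine ContinuousAt.div (by fun_prop) (by fun_prop) ?_
    simp only [one_pow, mul_one]
    nlinarith
  · refine Finset.prod_ne_zero_iff.2 fun i _ => ?_
    simp only [one_pow, mul_one]
    linarith

theorem tsum_TT (n : ℕ) (r : ℝ) (hr0 : 0 < r) (hr1 : r < 1) :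
    ∑' g : Fin n → ℕ, ENNReal.ofReal (TT n (fun k => r ^ k) (tq 1) g) =
      ENNReal.ofReal (VAL n r 1) := by
  let q : ℕ → ℝ := fun m => 1 - 1 / ((m : ℝ) + 1 + 1)
  have hq0 : ∀ m, 0 < q m := by
    intro m
    simp only [q, sub_pos]
    rw [div_lt_one (by positivity)]
    have : (0 : ℝ) ≤ m := by positivity
    linarith
  have hq1 : ∀ m, q m < 1 := by
    intro m
    simp only [q]
    have : 0 < 1 / ((m : ℝ) + 1 + 1) := by positivity
    linarith
  have hqm : Monotone q := by
    intro a b hab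
    simp only [q]
    have : (a : ℝ) ≤ b := by exact_mod_cast hab
    gcongr
  have hql : Filter.Tendsto q Filter.atTop (nhds 1) := by
    have h1 := tendsto_one_div_add_atTop_nhds_zero_nat (𝕜 := ℝ)
    have h2 := (Filter.tendsto_add_atTop_iff_nat 1).2 h1
    have h3 := h2.const_sub 1
    simpa [q] using h3
  have hmc := lintegral_tendsto_of_tendsto_of_monotone
    (μ := (Measure.count : Measure (Fin n → ℕ)))
    (f := fun m g => ENNReal.ofReal (TT n (fun k => r ^ k) (tq (q m)) g))
    (F := fun g => ENNReal.ofReal (TT n (fun k => r ^ k) (tq 1) g))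
    (fun m => (measurable_of_countable _).aemeasurable)
    (Filter.Eventually.of_forall fun g a b hab =>
      ENNReal.ofReal_le_ofReal (TT_mono n r _ _ hr0 (hq0 a).le (hqm hab) g))
    (Filter.Eventually.of_forall fun g =>
      ENNReal.tendsto_ofReal (((TT_cont n r g).tendsto 1).comp hql))
  simp only [lintegral_count] at hmc
  refine tendsto_nhds_unique hmc ?_
  have hv : Filter.Tendsto (fun m => ENNReal.ofReal (VAL n r (q m))) Filter.atTop
      (nhds (ENNReal.ofReal (VAL n r 1))) :=
    ENNReal.tendsto_ofReal ((VAL_cont n r hr0 hr1).tendsto.comp hql)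
  refine hv.congr fun m => ?_
  have hs := hasSum_TT n r (q m) hr0 hr1 (hq0 m) (hq1 m)
  rw [← hs.tsum_eq, ENNReal.ofReal_tsum_of_nonneg _ hs.summable]
  intro g
  refine TT_nonneg (fun k => by positivity) ?_ g
  intro a b hab
  exact Finset.sum_le_sum_of_subset_of_nonneg (by simpa using hab)
    fun i _ _ => pow_nonneg (hq0 m).le i

lemma pair_const (n : ℕ) (c : ℝ) :
    ∏ i : Fin n, ∏ _j ∈ Finset.Ioi i, c = c ^ (n * (n - 1) / 2) := by
  simp only [Finset.prod_const, Fin.card_Ioi]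
  rw [Finset.prod_pow_eq_pow_sum, Fin.sum_univ_eq_sum_range (fun i => n - 1 - i) n,
    Finset.sum_range_reflect (fun i => i) n, Finset.sum_range_id]

lemma single_const (n : ℕ) (c : ℝ) :
    ∏ i : Fin n, c ^ (i : ℕ) = c ^ (n * (n - 1) / 2) := by
  rw [Finset.prod_pow_eq_pow_sum, Fin.sum_univ_eq_sum_range (fun i => i) n,
    Finset.sum_range_id]

def cv (n : ℕ) (r : ℝ) (k : ℕ) : Fin n → ℝ := fun m => (k.choose m : ℝ) * r ^ (k - (m : ℕ))

lemma cv_zero (n : ℕ) (k : ℕ) (m : Fin n) : cv n 0 k m = if k = (m : ℕ) then 1 else 0 := by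
  unfold cv
  split_ifs with h
  · simp [h]
  · rcases lt_or_gt_of_ne h with h | h
    · simp [Nat.choose_eq_zero_of_lt h]
    · have : k - (m : ℕ) ≠ 0 := by omega
      simp [this]

lemma vol_cv_zero (n : ℕ) : Summable (cv n 0) ∧ volume (Zon (cv n 0)) = 2 ^ n := by
  constructor
  · rw [Pi.summable]
    intro m
    simp only [cv_zero]
    exact (hasSum_ite_eq (m : ℕ) (1 : ℝ)).summable
  · have key : ∀ (u : ℕ → ℝ) (x : Fin n → ℝ), HasSum (fun k => u k • cv n 0 k) x ↔
        ∀ m : Fin n, x m = u m := by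
      intro u x
      rw [Pi.hasSum]
      refine forall_congr' fun m => ?_
      have : HasSum (fun k => (u k • cv n 0 k) m) (u m) := by
        convert hasSum_ite_eq (m : ℕ) (u m) using 1
        funext k
        simp only [Pi.smul_apply, cv_zero, smul_eq_mul]
        split_ifs with h
        · simp [h]
        · simp
      exact ⟨fun h => h.unique this, fun h => h ▸ this⟩
    have : Zon (cv n 0) = Set.Icc (fun _ => -1) (fun _ => 1) := by
      ext x
      constructor
      · rintro ⟨u, hu, h⟩
        rw [key] at h
        constructor <;> intro m <;> rw [h m]
        · exact (abs_le.1 (hu m)).1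
        · exact (abs_le.1 (hu m)).2
      · rintro ⟨h1, h2⟩
        refine ⟨fun k => if h : k < n then x ⟨k, h⟩ else 0, fun k => ?_, ?_⟩
        · by_cases h : k < n
          · simp only [h, dif_pos]
            exact abs_le.2 ⟨h1 _, h2 _⟩
          · simp [h]
        · rw [key]
          intro m
          simp
    rw [this, Real.volume_Icc_pi]
    simp
    norm_num

noncomputable def LM (n : ℕ) (r : ℝ) : Matrix (Fin n) (Fin n) ℝ :=
  Matrix.of fun m i => (r⁻¹) ^ (m : ℕ) / ((m : ℕ).factorial : ℝ) *
    (descPochhammer ℝ (m : ℕ)).coeff (i : ℕ)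

lemma cv_eq (n : ℕ) (r : ℝ) (hr : 0 < r) (k : ℕ) :
    cv n r k = Matrix.toLin' (LM n r) (mv n (fun k => r ^ k) (fun k => (k : ℝ)) k) := by
  ext m
  have h1 : (descPochhammer ℝ (m : ℕ)).eval (k : ℝ) =
      ∑ i : Fin n, (descPochhammer ℝ (m : ℕ)).coeff i * (k : ℝ) ^ (i : ℕ) := by
    rw [Polynomial.eval_eq_sum_range' (n := n), Fin.sum_univ_eq_sum_range
      (fun i => (descPochhammer ℝ (m : ℕ)).coeff i * (k : ℝ) ^ i)]
    rw [descPochhammer_natDegree]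
    exact m.2
  have h2 : ((k.choose m : ℕ) : ℝ) = (descPochhammer ℝ (m : ℕ)).eval (k : ℝ) /
      ((m : ℕ).factorial : ℝ) := Nat.cast_choose_eq_descPochhammer_div ℝ k m
  have h3 : (k.choose m : ℝ) * r ^ (k - (m : ℕ)) = (k.choose m : ℝ) * (r ^ k * (r⁻¹) ^ (m : ℕ)) := by
    by_cases h : (m : ℕ) ≤ k
    · rw [pow_sub₀ _ hr.ne' h, inv_pow]
    · simp [Nat.choose_eq_zero_of_lt (not_le.1 h)]
  simp only [cv, h3, Matrix.toLin'_apply, Matrix.mulVec, dotProduct, LM, Matrix.of_apply, mv]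
  rw [h2, h1, Finset.sum_div, Finset.sum_mul]
  refine Finset.sum_congr rfl fun i _ => ?_
  ring

lemma LM_det (n : ℕ) (r : ℝ) (hr : 0 < r) :
    (LM n r).det * (r ^ (n * (n - 1) / 2) *
      ∏ i : Fin n, ∏ j ∈ Finset.Ioi i, (((j : ℕ) : ℝ) - ((i : ℕ) : ℝ))) = 1 := by
  have hV : (Matrix.of fun i k : Fin n => r ^ (k : ℕ) *
      (Matrix.vandermonde fun j : Fin n => ((j : ℕ) : ℝ)).transpose i k).det =
      r ^ (n * (n - 1) / 2) *
      ∏ i : Fin n, ∏ j ∈ Finset.Ioi i, (((j : ℕ) : ℝ) - ((i : ℕ) : ℝ)) := by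
    rw [Matrix.det_mul_row, Matrix.det_transpose, Matrix.det_vandermonde, single_const]
  rw [← hV, ← Matrix.det_mul]
  have : LM n r * (Matrix.of fun i k : Fin n => r ^ (k : ℕ) *
      (Matrix.vandermonde fun j : Fin n => ((j : ℕ) : ℝ)).transpose i k) =
      Matrix.of fun m k : Fin n => cv n r k m := by
    ext m k
    rw [Matrix.of_apply, cv_eq n r hr]
    rfl
  rw [this, Matrix.det_of_isUpperTriangular]
  · refine Finset.prod_eq_one fun i _ => ?_
    simp [cv]
  · intro i j h
    have h : j < i := h
    simp [cv, Nat.choose_eq_zero_of_lt (Fin.lt_def.1 h)]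

lemma VAL_one (n : ℕ) (r : ℝ) : VAL n r 1 = r ^ (n * (n - 1) / 2) *
      (∏ i : Fin n, ∏ j ∈ Finset.Ioi i, (((j : ℕ) : ℝ) - ((i : ℕ) : ℝ))) /
      ((1 - r) ^ n * (1 - r ^ 2) ^ (n * (n - 1) / 2)) := by
  unfold VAL tq
  simp only [one_pow, mul_one, Finset.sum_const, Finset.card_range, nsmul_eq_mul,
    Finset.prod_div_distrib, Finset.prod_mul_distrib, pair_const, ← pow_two]
  rw [div_div, Finset.prod_const, Finset.card_univ, Fintype.card_fin, mul_comm ((1 - r) ^ n)]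

lemma vol_cv (n : ℕ) (r : ℝ) (h0 : 0 ≤ r) (h1 : r < 1) : Summable (cv n r) ∧
    volume (Zon (cv n r)) = ENNReal.ofReal (2 ^ n /
      ((1 - r) ^ n * (1 - r ^ 2) ^ (n * (n - 1) / 2))) := by
  rcases h0.eq_or_lt with rfl | hr
  · refine ⟨(vol_cv_zero n).1, ?_⟩
    rw [(vol_cv_zero n).2]
    simp [ENNReal.ofReal_pow]
  · have hs : Summable (mv n (fun k => r ^ k) (fun k => (k : ℝ))) := by
      rw [Pi.summable]
      intro i
      have := summable_pow_mul_geometric_of_norm_lt_one (i : ℕ) (r := r)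
        (by rwa [Real.norm_eq_abs, abs_of_pos hr])
      refine this.congr fun k => ?_
      simp [mv, mul_comm]
    have hc : cv n r = fun k => Matrix.toLin' (LM n r) (mv n (fun k => r ^ k)
      (fun k => (k : ℝ)) k) := funext fun k => cv_eq n r hr k
    refine ⟨?_, ?_⟩
    · rw [hc]
      exact hs.map (Matrix.toLin' (LM n r)) (LinearMap.continuous_of_finiteDimensional _)
    · rw [hc, vol_zon_matrix hs, vol_zon_mv n _ _ (fun k => by positivity) Nat.strictMono_cast hs]
      have ht : (Nat.cast : ℕ → ℝ) = tq 1 := by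
        funext k
        simp [tq]
      rw [ht, tsum_TT n r hr h1, VAL_one]
      have hd := LM_det n r hr
      set d := r ^ (n * (n - 1) / 2) *
        (∏ i : Fin n, ∏ j ∈ Finset.Ioi i, (((j : ℕ) : ℝ) - ((i : ℕ) : ℝ))) with hdd
      have hdpos : 0 < d := by
        refine mul_pos (by positivity) (Finset.prod_pos fun i _ => Finset.prod_pos fun j hj => ?_)
        rw [sub_pos]
        exact_mod_cast Fin.lt_def.1 (Finset.mem_Ioi.1 hj)
      have hdet : |(LM n r).det| = d⁻¹ := by
        rw [eq_inv_of_mul_eq_one_left hd, abs_of_pos (by positivity)]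
      have h2 : (2 : ENNReal) ^ n = ENNReal.ofReal (2 ^ n) := by
        simp [ENNReal.ofReal_pow]
      rw [hdet, h2, ← ENNReal.ofReal_mul (by positivity), ← ENNReal.ofReal_mul (by positivity)]
      congr 1
      field_simp

def bb {n : ℕ} (b : Fin n → ℝ) (i : ℕ) : ℝ := if h : i < n then b ⟨i, h⟩ else 0

def shiftE : Module.End ℝ (ℕ → ℝ) where
  toFun f := fun i => f (i + 1)
  map_add' _ _ := rfl
  map_smul' _ _ := rfl

lemma shiftE_pow (m : ℕ) (f : ℕ → ℝ) (i : ℕ) : (shiftE ^ m) f i = f (i + m) := by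
  induction m generalizing i with
  | zero => simp
  | succ m ih =>
    rw [pow_succ']
    change (shiftE ^ m) f (i + 1) = _
    rw [ih]
    congr 1
    ring

lemma jordan_pow (r : ℝ) (f : ℕ → ℝ) (k i : ℕ) :
    ((shiftE + algebraMap ℝ (Module.End ℝ (ℕ → ℝ)) r) ^ k) f i =
      ∑ m ∈ Finset.range (k + 1), (k.choose m : ℝ) * r ^ (k - m) * f (i + m) := by
  have hc : Commute shiftE (algebraMap ℝ (Module.End ℝ (ℕ → ℝ)) r) :=
    (Algebra.commutes r shiftE).symm
  rw [hc.add_pow]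
  rw [LinearMap.sum_apply, Finset.sum_apply]
  refine Finset.sum_congr rfl fun m _ => ?_
  rw [← map_pow, mul_assoc, ← map_natCast (algebraMap ℝ (Module.End ℝ (ℕ → ℝ))), ← map_mul]
  rw [Module.End.mul_apply, Module.algebraMap_end_apply, map_smul, Pi.smul_apply, shiftE_pow, smul_eq_mul]
  ring

lemma jordan_vec {n : ℕ} {r : ℝ} {A : Matrix (Fin n) (Fin n) ℝ}
    (hA : ∀ i j : Fin n, A i j =
      if i = j then r else if (j : ℕ) = (i : ℕ) + 1 then 1 else 0)
    (b : Fin n → ℝ) (k : ℕ) :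
    bb ((A ^ k).mulVec b) = ((shiftE + algebraMap ℝ (Module.End ℝ (ℕ → ℝ)) r) ^ k) (bb b) := by
  induction k with
  | zero => simp
  | succ k ih =>
    rw [pow_succ', pow_succ', Module.End.mul_apply, ← ih, ← Matrix.mulVec_mulVec]
    set y := (A ^ k).mulVec b
    funext i
    change _ = bb y (i + 1) + r * bb y i
    by_cases hi : i < n
    · simp only [bb, hi, dif_pos]
      have : A.mulVec y ⟨i, hi⟩ = ∑ j : Fin n, ((if (j : ℕ) = i + 1 then y j else 0) +
          if (⟨i, hi⟩ : Fin n) = j then r * y j else 0) := by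
        rw [Matrix.mulVec, dotProduct]
        refine Finset.sum_congr rfl fun j _ => ?_
        rw [hA]
        by_cases h : (⟨i, hi⟩ : Fin n) = j
        · subst h
          simp
        · simp [h]
      rw [this, Finset.sum_add_distrib]
      congr 1
      · by_cases h : i + 1 < n
        · rw [dif_pos h, Finset.sum_eq_single ⟨i + 1, h⟩]
          · simp
          · intro j _ hj
            rw [if_neg]
            intro h'
            exact hj (Fin.ext h')
          · simp
        · rw [dif_neg h]
          refine Finset.sum_eq_zero fun j _ => ?_
          rw [if_neg]
          have := j.2
          omega
      · simp
    · have : ¬ i + 1 < n := by omega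
      simp [bb, hi, this]

def BM {n : ℕ} (b : Fin n → ℝ) : Matrix (Fin n) (Fin n) ℝ :=
  Matrix.of fun i m => bb b ((i : ℕ) + (m : ℕ))

lemma jordan_cv {n : ℕ} {r : ℝ} {A : Matrix (Fin n) (Fin n) ℝ}
    (hA : ∀ i j : Fin n, A i j =
      if i = j then r else if (j : ℕ) = (i : ℕ) + 1 then 1 else 0)
    (b : Fin n → ℝ) (k : ℕ) :
    (A ^ k).mulVec b = Matrix.toLin' (BM b) (cv n r k) := by
  funext i
  have h1 : (A ^ k).mulVec b i = bb ((A ^ k).mulVec b) i := by simp [bb]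
  rw [h1, jordan_vec hA, jordan_pow]
  have h2 : Matrix.toLin' (BM b) (cv n r k) i =
      ∑ m ∈ Finset.range n, (k.choose m : ℝ) * r ^ (k - m) * bb b ((i : ℕ) + m) := by
    rw [← Fin.sum_univ_eq_sum_range (fun m => (k.choose m : ℝ) * r ^ (k - m) * bb b ((i : ℕ) + m))]
    rw [Matrix.toLin'_apply, Matrix.mulVec, dotProduct]
    refine Finset.sum_congr rfl fun m _ => ?_
    simp only [BM, cv, Matrix.of_apply]
    ring
  rw [h2]
  have e1 := Finset.sum_subset (s₁ := Finset.range (k + 1)) (s₂ := Finset.range (k + 1 + n))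
    (f := fun m => (k.choose m : ℝ) * r ^ (k - m) * bb b ((i : ℕ) + m))
    (by intro m; simp; omega) (by
      intro m _ hm
      have : k < m := by simpa using hm
      simp [Nat.choose_eq_zero_of_lt this])
  have e2 := Finset.sum_subset (s₁ := Finset.range n) (s₂ := Finset.range (k + 1 + n))
    (f := fun m => (k.choose m : ℝ) * r ^ (k - m) * bb b ((i : ℕ) + m))
    (by intro m; simp; omega) (by
      intro m _ hm
      have : ¬ (i : ℕ) + m < n := by
        have : n ≤ m := by simpa using hm
        omega
      simp [bb, this])
  rw [e1, e2]

lemma BM_det {n : ℕ} (b : Fin n → ℝ) : |(BM b).det| = |bb b (n - 1)| ^ n := by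
  rw [← Matrix.abs_det_submatrix_equiv_equiv (Equiv.refl _) Fin.revPerm (BM b),
    Matrix.det_of_isUpperTriangular]
  · rw [Finset.abs_prod]
    have : ∀ i : Fin n, |(BM b).submatrix (Equiv.refl _) Fin.revPerm i i| = |bb b (n - 1)| := by
      intro i
      simp only [BM, Matrix.submatrix_apply, Matrix.of_apply, Equiv.refl_apply, Fin.revPerm_apply,
        Fin.val_rev]
      congr 2
      omega
    rw [Finset.prod_congr rfl fun i _ => this i]
    simp
  · intro i j h
    have h : j < i := h
    have h3 : ¬ (i : ℕ) + (n - ((j : ℕ) + 1)) < n := by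
      have := Fin.lt_def.1 h
      omega
    simp [BM, bb, Fin.val_rev, h3]

/-- For the `n×n` Jordan block `A` with eigenvalue `λ ∈ [0,1)` and
`b ∈ ℝⁿ` with last entry `bₙ`, the volume of the infinite-horizon reachable
zonotope equals `2ⁿ |bₙ|ⁿ / ((1-λ)ⁿ (1-λ²)^{n(n-1)/2})`. -/
theorem stmt9 (n : ℕ) (hn : 1 ≤ n) (lam : ℝ) (h0 : 0 ≤ lam) (h1 : lam < 1)
    (A : Matrix (Fin n) (Fin n) ℝ)
    (hA : ∀ i j : Fin n, A i j =
      if i = j then lam else if (j : ℕ) = (i : ℕ) + 1 then 1 else 0)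
    (b : Fin n → ℝ) :
    volume {x : Fin n → ℝ | ∃ u : ℕ → ℝ, (∀ k, |u k| ≤ 1) ∧
        HasSum (fun k : ℕ => u k • (A ^ k).mulVec b) x} =
    ENNReal.ofReal ((2 : ℝ) ^ n * |b ⟨n - 1, by omega⟩| ^ n /
      ((1 - lam) ^ n * (1 - lam ^ 2) ^ (n * (n - 1) / 2))) := by
  have hset : {x : Fin n → ℝ | ∃ u : ℕ → ℝ, (∀ k, |u k| ≤ 1) ∧
        HasSum (fun k : ℕ => u k • (A ^ k).mulVec b) x} =
      Zon (fun k => Matrix.toLin' (BM b) (cv n lam k)) := by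
    simp only [jordan_cv hA b]
    rfl
  obtain ⟨hs, hv⟩ := vol_cv n lam h0 h1
  have hb : bb b (n - 1) = b ⟨n - 1, by omega⟩ := by
    have : n - 1 < n := by omega
    simp [bb, this]
  rw [hset, vol_zon_matrix hs, hv, BM_det, hb, ← ENNReal.ofReal_mul (by positivity)]
  congr 1
  ring
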